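/- (Eigenvalues of the linearized rotating MHD symbol) Let ε > 0, α ∈ ℝ and ξ = (ξ₁,ξ₂,ξ₃) ∈ ℝ³ with ξ ≠ 0. Then for every X ∈ ℂ, det(𝔹(ξ,ε) − X·I₆) = Π_{i=1}^{6} (λ_i − X), where λ₁,₂ = −ε^α|ξ_h|² ± iξ₃/ε, λ₃,₄ = −ε^α|ξ_h|² ± iξ₃A/ε, λ₅,₆ = −ε^α|ξ_h|² ± iξ₃B/ε, with A = (1 + √(4|ξ|² + 1))/(2|ξ|) and B = (−1 + √(4|ξ|² + 1))/(2|ξ|). -/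

import Mathlib

/- Eigenvalues of the linearized rotating MHD symbol: the characteristic polynomial of
`𝔹(ξ,ε)` factors as the product of the six linear factors `(λ_i - X)`. -/

open Real
noncomputable section

/-- `A = (1 + √(4|ξ|² + 1))/(2|ξ|)`. -/
def Aval (ξ₁ ξ₂ ξ₃ : ℝ) : ℝ :=
  (1 + Real.sqrt (4 * (ξ₁^2 + ξ₂^2 + ξ₃^2) + 1)) / (2 * Real.sqrt (ξ₁^2 + ξ₂^2 + ξ₃^2))

/-- `B = (-1 + √(4|ξ|² + 1))/(2|ξ|)`. -/
def Bval (ξ₁ ξ₂ ξ₃ : ℝ) : ℝ :=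
  (-1 + Real.sqrt (4 * (ξ₁^2 + ξ₂^2 + ξ₃^2) + 1)) / (2 * Real.sqrt (ξ₁^2 + ξ₂^2 + ξ₃^2))

/-- the eigenvalue `-ε^α |ξ_h|² + i ξ₃ c / ε`. -/
def lamMHD (ε α ξ₁ ξ₂ ξ₃ c : ℝ) : ℂ :=
  -(((ε ^ α * (ξ₁^2 + ξ₂^2)) : ℝ) : ℂ) + Complex.I * ((ξ₃ * c / ε : ℝ) : ℂ)

/-- the matrix `𝔹(ξ,ε)` of the linearized rotating MHD system on the Fourier side. -/
def Bmat (ε α ξ₁ ξ₂ ξ₃ : ℝ) : Matrix (Fin 6) (Fin 6) ℂ :=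
  let m : ℂ := ((ε ^ α * (ξ₁^2 + ξ₂^2) : ℝ) : ℂ)
  let N : ℝ := ξ₁^2 + ξ₂^2 + ξ₃^2
  let c : ℂ := Complex.I * ((ξ₃ / ε : ℝ) : ℂ)
  !![ -m + ((ξ₁*ξ₂/(ε*N) : ℝ) : ℂ), (((ξ₂^2+ξ₃^2)/(ε*N) : ℝ) : ℂ), 0, -c, 0, 0 ;
      -((((ξ₁^2+ξ₃^2)/(ε*N)) : ℝ) : ℂ), -m - ((ξ₁*ξ₂/(ε*N) : ℝ) : ℂ), 0, 0, -c, 0 ;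
      ((ξ₂*ξ₃/(ε*N) : ℝ) : ℂ), -(((ξ₁*ξ₃/(ε*N)) : ℝ) : ℂ), -m, 0, 0, -c ;
      -c, 0, 0, -m, 0, 0 ;
      0, -c, 0, 0, -m, 0 ;
      0, 0, -c, 0, 0, -m ]

theorem det_coupled_block {R : Type*} [CommRing R] (y a b c d e f : R) :
    (!![y + a, b, 0, -c, 0, 0;
        -d, y - a, 0, 0, -c, 0;
        e, -f, y, 0, 0, -c;
        -c, 0, 0, y, 0, 0;
        0, -c, 0, 0, y, 0;
        0, 0, -c, 0, 0, y] : Matrix (Fin 6) (Fin 6) R).det =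
      (y ^ 2 - c ^ 2) * ((y ^ 2 - c ^ 2) ^ 2 + y ^ 2 * (b * d - a ^ 2)) := by
  simp [Matrix.det_succ_row_zero, Fin.sum_univ_succ, Fin.succAbove, Matrix.submatrix]
  ring

theorem normSq_pos {ξ₁ ξ₂ ξ₃ : ℝ} (hξ : ¬(ξ₁ = 0 ∧ ξ₂ = 0 ∧ ξ₃ = 0)) :
    0 < ξ₁ ^ 2 + ξ₂ ^ 2 + ξ₃ ^ 2 := by
  by_contra! h
  refine hξ ⟨?_, ?_, ?_⟩ <;>
    exact pow_eq_zero_iff two_ne_zero |>.mp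
      (by nlinarith [sq_nonneg ξ₁, sq_nonneg ξ₂, sq_nonneg ξ₃])

theorem Aval_mul_Bval {ξ₁ ξ₂ ξ₃ : ℝ} (hN : 0 < ξ₁ ^ 2 + ξ₂ ^ 2 + ξ₃ ^ 2) :
    Aval ξ₁ ξ₂ ξ₃ * Bval ξ₁ ξ₂ ξ₃ = 1 := by
  unfold Aval Bval
  have h₁ := Real.sq_sqrt hN.le
  have h₂ := Real.sq_sqrt (show 0 ≤ 4 * (ξ₁ ^ 2 + ξ₂ ^ 2 + ξ₃ ^ 2) + 1 by positivity)
  have h₃ := Real.sqrt_pos.mpr hN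
  rw [div_mul_div_comm, div_eq_one_iff_eq (by positivity)]
  linear_combination h₂ - 4 * h₁

theorem Aval_sq_add_Bval_sq {ξ₁ ξ₂ ξ₃ : ℝ} (hN : 0 < ξ₁ ^ 2 + ξ₂ ^ 2 + ξ₃ ^ 2) :
    Aval ξ₁ ξ₂ ξ₃ ^ 2 + Bval ξ₁ ξ₂ ξ₃ ^ 2 = 2 + 1 / (ξ₁ ^ 2 + ξ₂ ^ 2 + ξ₃ ^ 2) := by
  have h : Aval ξ₁ ξ₂ ξ₃ - Bval ξ₁ ξ₂ ξ₃ = 1 / √(ξ₁ ^ 2 + ξ₂ ^ 2 + ξ₃ ^ 2) := by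
    have h₃ := Real.sqrt_pos.mpr hN
    unfold Aval Bval
    rw [← sub_div, div_eq_div_iff (by positivity) h₃.ne']
    ring
  have h' := congrArg (· ^ 2) h
  simp only [div_pow, one_pow, Real.sq_sqrt hN.le] at h'
  linear_combination h' + 2 * Aval_mul_Bval hN

theorem lamMHD_sub_mul_neg (ε α ξ₁ ξ₂ ξ₃ c : ℝ) (X : ℂ) :
    (lamMHD ε α ξ₁ ξ₂ ξ₃ c - X) * (lamMHD ε α ξ₁ ξ₂ ξ₃ (-c) - X) =
      (-((ε ^ α * (ξ₁ ^ 2 + ξ₂ ^ 2) : ℝ) : ℂ) - X) ^ 2 + ((ξ₃ / ε : ℝ) : ℂ) ^ 2 * (c : ℂ) ^ 2 := by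
  unfold lamMHD
  push_cast
  linear_combination (-(ξ₃ / ε * c : ℂ) ^ 2) * Complex.I_sq

theorem eigenvalues_linearized_MHD_symbol (ε α ξ₁ ξ₂ ξ₃ : ℝ) (hε : 0 < ε)
    (hξ : ¬(ξ₁ = 0 ∧ ξ₂ = 0 ∧ ξ₃ = 0)) (X : ℂ) :
    (Bmat ε α ξ₁ ξ₂ ξ₃ - X • (1 : Matrix (Fin 6) (Fin 6) ℂ)).det =
      (lamMHD ε α ξ₁ ξ₂ ξ₃ 1 - X) * (lamMHD ε α ξ₁ ξ₂ ξ₃ (-1) - X) *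
      (lamMHD ε α ξ₁ ξ₂ ξ₃ (Aval ξ₁ ξ₂ ξ₃) - X) *
      (lamMHD ε α ξ₁ ξ₂ ξ₃ (-(Aval ξ₁ ξ₂ ξ₃)) - X) *
      (lamMHD ε α ξ₁ ξ₂ ξ₃ (Bval ξ₁ ξ₂ ξ₃) - X) *
      (lamMHD ε α ξ₁ ξ₂ ξ₃ (-(Bval ξ₁ ξ₂ ξ₃)) - X) := by
  have hN := normSq_pos hξ
  set N := ξ₁ ^ 2 + ξ₂ ^ 2 + ξ₃ ^ 2 with hN_def
  set y : ℂ := -((ε ^ α * (ξ₁ ^ 2 + ξ₂ ^ 2) : ℝ) : ℂ) - X with hy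
  have hdet : (Bmat ε α ξ₁ ξ₂ ξ₃ - X • (1 : Matrix (Fin 6) (Fin 6) ℂ)).det =
      (y ^ 2 - (Complex.I * ((ξ₃ / ε : ℝ) : ℂ)) ^ 2) *
        ((y ^ 2 - (Complex.I * ((ξ₃ / ε : ℝ) : ℂ)) ^ 2) ^ 2 +
          y ^ 2 * ((((ξ₂ ^ 2 + ξ₃ ^ 2) / (ε * N) : ℝ) : ℂ) *
            (((ξ₁ ^ 2 + ξ₃ ^ 2) / (ε * N) : ℝ) : ℂ) - ((ξ₁ * ξ₂ / (ε * N) : ℝ) : ℂ) ^ 2)) := by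
    rw [← det_coupled_block _ _ _ _ _ ((ξ₂ * ξ₃ / (ε * N) : ℝ) : ℂ)
      ((ξ₁ * ξ₃ / (ε * N) : ℝ) : ℂ)]
    congr 1
    ext i j
    fin_cases i <;> fin_cases j <;> simp [Bmat, hy, hN_def] <;> ring
  have hJ : (ξ₂ ^ 2 + ξ₃ ^ 2) / (ε * N) * ((ξ₁ ^ 2 + ξ₃ ^ 2) / (ε * N)) -
      (ξ₁ * ξ₂ / (ε * N)) ^ 2 = (ξ₃ / ε) ^ 2 * (1 / N) := by
    field_simp
    rw [hN_def]
    ring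
  have hJ' := congrArg (fun x : ℝ => (x : ℂ)) hJ
  have hAB := congrArg (fun x : ℝ => (x : ℂ)) (Aval_mul_Bval hN)
  have hsum := congrArg (fun x : ℝ => (x : ℂ)) (Aval_sq_add_Bval_sq hN)
  simp only [Complex.ofReal_sub, Complex.ofReal_mul, Complex.ofReal_pow, Complex.ofReal_add,
    Complex.ofReal_one, Complex.ofReal_ofNat] at hJ' hAB hsum
  have h_one := lamMHD_sub_mul_neg ε α ξ₁ ξ₂ ξ₃ 1 X
  have hA := lamMHD_sub_mul_neg ε α ξ₁ ξ₂ ξ₃ (Aval ξ₁ ξ₂ ξ₃) X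
  have hB := lamMHD_sub_mul_neg ε α ξ₁ ξ₂ ξ₃ (Bval ξ₁ ξ₂ ξ₃) X
  rw [← hN_def] at hsum
  rw [← hy] at h_one hA hB
  rw [hdet, hJ', mul_pow, Complex.I_sq, h_one, mul_assoc (_ * _), hB,
    mul_assoc (y ^ 2 + _), hA, Complex.ofReal_one]
  set k : ℂ := ((ξ₃ / ε : ℝ) : ℂ) ^ 2
  linear_combination (-(y ^ 2 + k) * k * y ^ 2) * hsum -
    (y ^ 2 + k) * k ^ 2 * ((Aval ξ₁ ξ₂ ξ₃ : ℂ) * Bval ξ₁ ξ₂ ξ₃ + 1) * hAB
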